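/- There is a constant C > 0 such that every definite, purely negative 2-program P without dual clauses has at most C · 1.23651^n stable models, where n = |At(P)| (here 1.23651 denotes the rational number 123651/100000). -/

import Mathlib

/-- A clause of a propositional logic program: an optional head (a definite
clause if `head = some h`, a constraint if `head = none`), a positive body
and a negative body. -/
structure LPClause (α : Type) where
  head : Option α
  pos : Finset α
  neg : Finset α
deriving DecidableEq

/-- A program is a finite set of clauses. -/
abbrev LPProgram (α : Type) := Finset (LPClause α)

/-- The atoms occurring in a clause. -/
def LPClause.atoms {α : Type} [DecidableEq α] (c : LPClause α) : Finset α :=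
  c.head.toFinset ∪ c.pos ∪ c.neg

/-- The atoms occurring in a program. -/
def LPProgram.atoms {α : Type} [DecidableEq α] (P : LPProgram α) : Finset α :=
  P.sup LPClause.atoms

/-- `N` is closed under the Horn rules of the reduct `P^M`: for every definite
clause of `P` whose negative body is disjoint from `M`, if its positive body
is contained in `N` then so is its head. -/
def ClosedUnder {α : Type} (P : LPProgram α) (M : Finset α) (N : Set α) : Prop :=
  ∀ c ∈ P, ∀ h : α, c.head = some h → (∀ b ∈ c.neg, b ∉ M) →
    (↑c.pos : Set α) ⊆ N → h ∈ N

/-- `M` is a stable model of `P`: `M` is the least set closed under the rules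
of the reduct `P^M` (i.e. `M = lm(P^M)`), and `M` satisfies every constraint
of `P`. -/
def IsStable {α : Type} (P : LPProgram α) (M : Finset α) : Prop :=
  ClosedUnder P M ↑M ∧ (∀ N : Set α, ClosedUnder P M N → ↑M ⊆ N) ∧
  ∀ c ∈ P, c.head = none → ¬(c.pos ⊆ M ∧ ∀ b ∈ c.neg, b ∉ M)

/-- `P` is a `t`-program: every clause has at most `t` literals, counting the head. -/
def IsTProgram {α : Type} (P : LPProgram α) (t : ℕ) : Prop :=
  ∀ c ∈ P, c.pos.card + c.neg.card + (c.head.elim 0 fun _ => 1) ≤ t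

open scoped Classical in
/-- The kernels of the digraph `R` restricted to `V`: the independent subsets of `V` from which
there is an edge to every other vertex of `V`. -/
noncomputable def kernels {α : Type} (R : α → α → Prop) (V : Finset α) : Finset (Finset α) :=
  V.powerset.filter fun S => ∀ a ∈ V, (a ∈ S ↔ ∀ b ∈ V, R b a → b ∉ S)

open scoped Classical in
/-- In-neighbours of `v` in `V`. -/
noncomputable def inNbrs {α : Type} (R : α → α → Prop) (V : Finset α) (v : α) : Finset α :=
  V.filter fun u => R u v

open scoped Classical in
/-- Out-neighbours of `v` in `V`. -/
noncomputable def outNbrs {α : Type} (R : α → α → Prop) (V : Finset α) (v : α) : Finset α :=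
  V.filter fun u => R v u

open scoped Classical in
/-- The closed neighbourhood of `v` in `V`. -/
noncomputable def closedNbrs {α : Type} (R : α → α → Prop) (V : Finset α) (v : α) : Finset α :=
  V.filter fun u => u = v ∨ R u v ∨ R v u

section Kernels

open scoped Classical

variable {α : Type} {R : α → α → Prop} {V : Finset α}

lemma mem_kernels {S : Finset α} : S ∈ kernels R V ↔
    S ⊆ V ∧ ∀ a ∈ V, (a ∈ S ↔ ∀ b ∈ V, R b a → b ∉ S) := by
  simp [kernels]

lemma kernels_indep {S : Finset α} (hS : S ∈ kernels R V) {a b : α} (ha : a ∈ S) (hb : b ∈ S) :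
    ¬ R a b := fun h =>
  have hV := (mem_kernels.1 hS).1
  ((mem_kernels.1 hS).2 b (hV hb)).1 hb a (hV ha) h ha

lemma kernels_exists_pred {S : Finset α} (hS : S ∈ kernels R V) {a : α} (ha : a ∈ V)
    (haS : a ∉ S) : ∃ b ∈ V, R b a ∧ b ∈ S := by
  by_contra! h
  exact haS (((mem_kernels.1 hS).2 a ha).2 h)

/-- Kernels with a prescribed trace `T` on `X`, where no edge leads from `T` out of `X`, are
kernels of the rest. -/
lemma card_filter_kernels_le_sdiff {F : Finset α → Prop} [DecidablePred F] (X T : Finset α)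
    (hF : ∀ S ∈ kernels R V, F S → S ∩ X = T)
    (hT : ∀ t ∈ T, ∀ u ∈ V, R t u → u ∈ X) :
    ((kernels R V).filter F).card ≤ (kernels R (V \ X)).card := by
  apply Finset.card_le_card_of_injOn (fun S => S \ X)
  · intro S hS
    obtain ⟨hS, hFS⟩ := Finset.mem_filter.1 hS
    have hX := hF S hS hFS
    obtain ⟨hSV, hk⟩ := mem_kernels.1 hS
    refine mem_kernels.2 ⟨Finset.sdiff_subset_sdiff hSV le_rfl, fun a ha => ?_⟩
    obtain ⟨haV, haX⟩ := Finset.mem_sdiff.1 ha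
    simp only [Finset.mem_sdiff, haX, not_false_eq_true, and_true, hk a haV]
    constructor
    · intro h b hb hR hbS
      exact h b hb.1 hR hbS.1
    · intro h b hb hR hbS
      by_cases hbX : b ∈ X
      · exact haX (hT b (hX ▸ Finset.mem_inter.2 ⟨hbS, hbX⟩) a haV hR)
      · exact h b ⟨hb, hbX⟩ hR ⟨hbS, hbX⟩
  · intro S hS S' hS' h
    obtain ⟨hS, hFS⟩ := Finset.mem_filter.1 hS
    obtain ⟨hS', hFS'⟩ := Finset.mem_filter.1 hS'
    have h1 := hF S hS hFS
    have h2 := hF S' hS' hFS'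
    rw [← Finset.sdiff_union_inter S X, ← Finset.sdiff_union_inter S' X, h1, h2]
    exact congrArg (· ∪ T) h

/-- A sink does not influence the rest of a kernel. -/
lemma card_kernels_le_erase_of_sink {v : α} (hv : v ∈ V) (hs : ∀ u ∈ V, ¬ R v u) :
    (kernels R V).card ≤ (kernels R (V.erase v)).card := by
  have key : ∀ S ∈ kernels R V, ∀ S' : Finset α, S.erase v = S'.erase v →
      (v ∈ S ↔ ∀ b ∈ V, R b v → b ∉ S') := by
    intro S hS S' h
    have hmem : ∀ b, b ≠ v → (b ∈ S ↔ b ∈ S') := fun b hb => by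
      have := Finset.ext_iff.1 h b
      simpa [hb] using this
    rw [(mem_kernels.1 hS).2 v hv]
    refine forall₃_congr fun b hb hR => not_congr (hmem b ?_)
    rintro rfl
    exact hs b hb hR
  apply Finset.card_le_card_of_injOn (fun S => S.erase v)
  · intro S hS
    obtain ⟨hSV, hk⟩ := mem_kernels.1 hS
    refine mem_kernels.2 ⟨Finset.erase_subset_erase _ hSV, fun a ha => ?_⟩
    obtain ⟨hav, haV⟩ := Finset.mem_erase.1 ha
    simp only [Finset.mem_erase, hav, ne_eq, not_false_eq_true, true_and, hk a haV]
    constructor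
    · intro h b hb hR hbS
      exact h b hb.2 hR hbS.2
    · intro h b hb hR hbS
      by_cases hbv : b = v
      · exact hs a haV (hbv ▸ hR)
      · exact h b ⟨hbv, hb⟩ hR ⟨hbv, hbS⟩
  · intro S hS S' hS' h
    have hv' : v ∈ S ↔ v ∈ S' := (key S hS S' h).trans (key S' hS' S' rfl).symm
    ext b
    by_cases hb : b = v
    · rw [hb, hv']
    · have := Finset.ext_iff.1 h b
      simpa [hb] using this

lemma card_le_two_branches (A : Finset (Finset α)) (F G : Finset α → Prop)
    [DecidablePred F] [DecidablePred G]
    (h : ∀ S ∈ A, F S ∨ G S) : A.card ≤ (A.filter F).card + (A.filter G).card := by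
  refine le_trans (Finset.card_le_card fun S hS => ?_) (Finset.card_union_le _ _)
  simpa [hS] using h S hS

lemma card_le_three_branches (A : Finset (Finset α)) (F G H : Finset α → Prop)
    [DecidablePred F] [DecidablePred G] [DecidablePred H]
    (h : ∀ S ∈ A, F S ∨ G S ∨ H S) :
    A.card ≤ (A.filter F).card + (A.filter G).card + (A.filter H).card := by
  refine le_trans (Finset.card_le_card fun S hS => ?_)
    ((Finset.card_union_le _ _).trans (Nat.add_le_add_right (Finset.card_union_le _ _) _))
  simpa [hS, or_assoc] using h S hS

/-- The bound on the number of kernels holds for all proper subsets of `V`. -/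
def KernelBoundBelow (R : α → α → Prop) (V : Finset α) : Prop :=
  ∀ W, W ⊂ V → ((kernels R W).card : ℝ) ≤ (123651 / 100000 : ℝ) ^ W.card

/-- Given the bound below `V`, a subset obtained by deleting at least `m` vertices satisfies
the bound with a gain of `m` factors. -/
lemma KernelBoundBelow.card_le (hV : KernelBoundBelow R V) {W Z : Finset α} {m : ℕ}
    (hW : W ⊆ V) (hZ : Z ⊆ V) (hWZ : Disjoint W Z) (hm : 0 < m) (hmZ : m ≤ Z.card) :
    ((kernels R W).card : ℝ) ≤ (123651 / 100000 : ℝ) ^ V.card * (100000 / 123651 : ℝ) ^ m := by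
  have hcard : W.card + m ≤ V.card := by
    have := Finset.card_le_card (Finset.union_subset hW hZ)
    rw [Finset.card_union_of_disjoint hWZ] at this
    omega
  have hne : W ⊂ V := Finset.ssubset_iff_subset_ne.2 ⟨hW, by rintro rfl; omega⟩
  refine (hV W hne).trans ?_
  obtain ⟨k, hk⟩ := Nat.exists_eq_add_of_le hcard
  have h1 : (123651 / 100000 : ℝ) ^ m * (100000 / 123651 : ℝ) ^ m = 1 := by
    rw [← mul_pow]; norm_num
  have h2 : (1 : ℝ) ≤ (123651 / 100000 : ℝ) ^ k := one_le_pow₀ (by norm_num)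
  have h3 : (0 : ℝ) < (123651 / 100000 : ℝ) ^ W.card := by positivity
  calc (123651 / 100000 : ℝ) ^ W.card
      ≤ (123651 / 100000 : ℝ) ^ W.card * (123651 / 100000 : ℝ) ^ k :=
        le_mul_of_one_le_right h3.le h2
    _ = _ := by
      rw [hk, pow_add, pow_add]
      linear_combination (-(123651 / 100000 : ℝ) ^ W.card * (123651 / 100000 : ℝ) ^ k) * h1

/-- Branch in which all vertices of `T` are selected and those of `D` are not: the vertices
of `T` and `D` and the neighbours of `T` are deleted. -/
lemma KernelBoundBelow.branch (hV : KernelBoundBelow R V) {F : Finset α → Prop} [DecidablePred F]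
    (T D Z : Finset α) {m : ℕ} (hm : 0 < m) (hmZ : m ≤ Z.card)
    (hT : ∀ S ∈ kernels R V, F S → T ⊆ S) (hD : ∀ S ∈ kernels R V, F S → Disjoint D S)
    (hZV : Z ⊆ V) (hZ : ∀ z ∈ Z, z ∈ D ∨ ∃ t ∈ T, z = t ∨ R z t ∨ R t z) :
    (((kernels R V).filter F).card : ℝ) ≤
      (123651 / 100000 : ℝ) ^ V.card * (100000 / 123651 : ℝ) ^ m := by
  set X := V.filter fun z => z ∈ D ∨ ∃ t ∈ T, z = t ∨ R z t ∨ R t z with hX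
  have hZX : Z ⊆ X := fun z hz => Finset.mem_filter.2 ⟨hZV hz, hZ z hz⟩
  refine le_trans (Nat.cast_le.2 (card_filter_kernels_le_sdiff X T ?_ ?_))
    (hV.card_le Finset.sdiff_subset hZV
      (Finset.disjoint_of_subset_right hZX Finset.sdiff_disjoint) hm hmZ)
  · intro S hS hF
    ext z
    simp only [hX, Finset.mem_inter, Finset.mem_filter]
    constructor
    · rintro ⟨hzS, -, hzD | ⟨t, ht, rfl | hR | hR⟩⟩
      · exact absurd hzS (Finset.disjoint_left.1 (hD S hS hF) hzD)
      · exact ht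
      · exact absurd hR (kernels_indep hS hzS (hT S hS hF ht))
      · exact absurd hR (kernels_indep hS (hT S hS hF ht) hzS)
    · intro hz
      have hzS := hT S hS hF hz
      exact ⟨hzS, (mem_kernels.1 hS).1 hzS, Or.inr ⟨z, hz, Or.inl rfl⟩⟩
  · intro t ht u hu hR
    exact Finset.mem_filter.2 ⟨hu, Or.inr ⟨t, ht, Or.inr (Or.inr hR)⟩⟩

/-- Branch on the kernels containing `v`. -/
lemma KernelBoundBelow.branch_mem (hV : KernelBoundBelow R V) (v : α) {m : ℕ} (hm : 0 < m)
    (hmv : m ≤ (closedNbrs R V v).card) :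
    (((kernels R V).filter fun S => v ∈ S).card : ℝ) ≤
      (123651 / 100000 : ℝ) ^ V.card * (100000 / 123651 : ℝ) ^ m := by
  refine hV.branch {v} ∅ (closedNbrs R V v) hm hmv ?_ ?_ (Finset.filter_subset _ _) ?_
  · intro S _ h
    simpa using h
  · simp
  · intro z hz
    exact Or.inr ⟨v, by simp, (Finset.mem_filter.1 hz).2⟩

lemma card_filter_notMem_le (v : α) :
    ((kernels R V).filter fun S => v ∉ S).card ≤ (kernels R (V.erase v)).card := by
  rw [Finset.erase_eq]
  refine card_filter_kernels_le_sdiff {v} ∅ ?_ (by simp)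
  intro S _ h
  exact Finset.inter_singleton_of_notMem h

/-- If the branches have total weight at most one, the bound holds for `V`. -/
lemma le_of_weight_le_one {a n : ℕ} {w : ℝ} (hw : w ≤ 1)
    (h : (a : ℝ) ≤ (123651 / 100000 : ℝ) ^ n * w) : (a : ℝ) ≤ (123651 / 100000 : ℝ) ^ n :=
  h.trans (mul_le_of_le_one_right (by positivity) hw)

lemma card_closedNbrs (hR : ∀ a b, R a b → ¬ R b a) {v : α} (hv : v ∈ V) :
    (closedNbrs R V v).card = 1 + (inNbrs R V v).card + (outNbrs R V v).card := by
  have h : closedNbrs R V v = ({v} ∪ inNbrs R V v) ∪ outNbrs R V v := by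
    ext u
    simp only [closedNbrs, inNbrs, outNbrs, Finset.mem_filter, Finset.mem_union,
      Finset.mem_singleton]
    constructor
    · tauto
    · rintro ((rfl | h) | h) <;> tauto
  rw [h, Finset.card_union_of_disjoint, Finset.card_union_of_disjoint, Finset.card_singleton]
  · simp only [inNbrs, Finset.disjoint_singleton_left, Finset.mem_filter, not_and]
    exact fun _ h => hR v v h h
  · rw [Finset.disjoint_left]
    intro u hu hu'
    simp only [inNbrs, outNbrs, Finset.mem_filter, Finset.mem_union,
      Finset.mem_singleton] at hu hu'
    rcases hu with rfl | hu
    · exact hR u u hu'.2 hu'.2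
    · exact hR _ _ hu.2 hu'.2

lemma eq_pred_of_inNbrs {u v b : α} (h : inNbrs R V v = {u}) (hb : b ∈ V) (hbv : R b v) :
    b = u := by
  have : b ∈ inNbrs R V v := Finset.mem_filter.2 ⟨hb, hbv⟩
  simpa [h] using this

lemma pred_of_inNbrs {u v : α} (h : inNbrs R V v = {u}) : u ∈ V ∧ R u v := by
  have : u ∈ inNbrs R V v := by simp [h]
  exact Finset.mem_filter.1 this

/-- Selection of `v` is equivalent to rejection of its unique predecessor. -/
lemma mem_iff_of_inNbrs {S : Finset α} (hS : S ∈ kernels R V) {u v : α} (hv : v ∈ V)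
    (h : inNbrs R V v = {u}) : v ∈ S ↔ u ∉ S := by
  obtain ⟨hu, huv⟩ := pred_of_inNbrs h
  constructor
  · exact fun hvS huS => kernels_indep hS huS hvS huv
  · intro huS
    by_contra hvS
    obtain ⟨b, hb, hbv, hbS⟩ := kernels_exists_pred hS hv hvS
    exact huS (eq_pred_of_inNbrs h hb hbv ▸ hbS)

/-- A vertex with a unique predecessor, one of the two having degree at least three. -/
lemma KernelBoundBelow.of_unique_pred_of_degree (hV : KernelBoundBelow R V) {u v : α} (hv : v ∈ V)
    (h : inNbrs R V v = {u}) (hu3 : 3 ≤ (closedNbrs R V u).card)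
    (hv3 : 3 ≤ (closedNbrs R V v).card)
    (h4 : 4 ≤ (closedNbrs R V u).card ∨ 4 ≤ (closedNbrs R V v).card) :
    ((kernels R V).card : ℝ) ≤ (123651 / 100000 : ℝ) ^ V.card := by
  have hc := card_le_two_branches (kernels R V) (fun S => u ∈ S) (fun S => v ∈ S)
    fun S hS => by rw [mem_iff_of_inNbrs hS hv h]; tauto
  have hc' : ((kernels R V).card : ℝ) ≤ _ := Nat.cast_le.2 hc
  push_cast at hc'
  refine le_of_weight_le_one
    (w := (100000 / 123651 : ℝ) ^ 3 + (100000 / 123651 : ℝ) ^ 4) (by norm_num) ?_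
  rcases h4 with h4 | h4
  · linarith [hV.branch_mem u (by norm_num) h4, hV.branch_mem v (by norm_num) hv3]
  · linarith [hV.branch_mem u (by norm_num) hu3, hV.branch_mem v (by norm_num) h4]

/-- Three consecutive vertices with a unique predecessor. -/
lemma KernelBoundBelow.of_unique_pred_chain (hR : ∀ a b, R a b → ¬ R b a)
    (hV : KernelBoundBelow R V) {t w u v : α} (hv : v ∈ V)
    (huv : inNbrs R V v = {u}) (hwu : inNbrs R V u = {w}) (htw : inNbrs R V w = {t}) :
    ((kernels R V).card : ℝ) ≤ (123651 / 100000 : ℝ) ^ V.card := by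
  obtain ⟨hu, ruv⟩ := pred_of_inNbrs huv
  obtain ⟨hw, rwu⟩ := pred_of_inNbrs hwu
  obtain ⟨ht, rtw⟩ := pred_of_inNbrs htw
  have hirr : ∀ a, ¬ R a a := fun a h => hR a a h h
  have hiff := fun S (hS : S ∈ kernels R V) =>
    And.intro (mem_iff_of_inNbrs hS hv huv)
      (And.intro (mem_iff_of_inNbrs hS hu hwu) (mem_iff_of_inNbrs hS hw htw))
  by_cases htv : t = v
  · subst htv
    have : kernels R V = ∅ := by
      rw [Finset.eq_empty_iff_forall_notMem]
      intro S hS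
      have := hiff S hS
      tauto
    rw [this]
    simp only [Finset.card_empty, Nat.cast_zero]
    positivity
  have hZ : ({t, w, u, v} : Finset α).card = 4 := by
    have h1 : t ≠ w := by rintro rfl; exact hirr _ rtw
    have h2 : w ≠ u := by rintro rfl; exact hirr _ rwu
    have h3 : u ≠ v := by rintro rfl; exact hirr _ ruv
    have h4 : t ≠ u := by rintro rfl; exact hR _ _ rtw rwu
    have h5 : w ≠ v := by rintro rfl; exact hR _ _ rwu ruv
    simp [*]
  have hZV : ({t, w, u, v} : Finset α) ⊆ V := by
    simp [Finset.insert_subset_iff, *]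
  have hc := card_le_two_branches (kernels R V) (fun S => u ∈ S) (fun S => u ∉ S)
    fun S _ => em _
  have hc' : ((kernels R V).card : ℝ) ≤ _ := Nat.cast_le.2 hc
  push_cast at hc'
  refine le_of_weight_le_one
    (w := (100000 / 123651 : ℝ) ^ 4 + (100000 / 123651 : ℝ) ^ 4) (by norm_num) ?_
  have b1 := hV.branch (F := fun S => u ∈ S) {u, t} ∅ {t, w, u, v} (by norm_num) hZ.ge
    (fun S hS hF => by
      have := hiff S hS
      simp only [Finset.insert_subset_iff, Finset.singleton_subset_iff]
      tauto) (by simp) hZV (by simp [*])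
  have b2 := hV.branch (F := fun S => u ∉ S) {v, w} ∅ {t, w, u, v} (by norm_num) hZ.ge
    (fun S hS hF => by
      have := hiff S hS
      simp only [Finset.insert_subset_iff, Finset.singleton_subset_iff]
      tauto) (by simp) hZV (by simp [*])
  linarith

/-- Branching on the unique successor `v` of a vertex `p`. -/
lemma KernelBoundBelow.of_unique_succ_of_degree (hR : ∀ a b, R a b → ¬ R b a)
    (hV : KernelBoundBelow R V) {p v : α} (hp : p ∈ V) (h : outNbrs R V p = {v})
    (h5 : 5 ≤ (closedNbrs R V v).card) :
    ((kernels R V).card : ℝ) ≤ (123651 / 100000 : ℝ) ^ V.card := by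
  have hmem : ∀ u, u ∈ V ∧ R p u ↔ u = v := fun u => by
    have := Finset.ext_iff.1 h u
    simpa [outNbrs] using this
  obtain ⟨hv, hpv⟩ := (hmem v).2 rfl
  have hne : p ≠ v := by rintro rfl; exact hR _ _ hpv hpv
  have hc := card_le_two_branches (kernels R V) (fun S => v ∈ S) (fun S => v ∉ S)
    fun S _ => em _
  have hc' : ((kernels R V).card : ℝ) ≤ _ := Nat.cast_le.2 hc
  push_cast at hc'
  refine le_of_weight_le_one
    (w := (100000 / 123651 : ℝ) ^ 5 + (100000 / 123651 : ℝ) ^ 2) (by norm_num) ?_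
  have h1 := hV.branch_mem v (by norm_num) h5
  have h2 := (card_filter_notMem_le (R := R) (V := V) v).trans
    (card_kernels_le_erase_of_sink (v := p) (by simp [hp, hne]) fun u hu hpu =>
      (Finset.mem_erase.1 hu).1 ((hmem u).1 ⟨(Finset.mem_erase.1 hu).2, hpu⟩))
  have h2' : (((kernels R V).filter fun S => v ∉ S).card : ℝ) ≤ _ := Nat.cast_le.2 h2
  have h3 := hV.card_le (W := (V.erase v).erase p) (Z := {p, v}) (m := 2)
    ((Finset.erase_subset _ _).trans (Finset.erase_subset _ _))
    (by simp [Finset.insert_subset_iff, *]) (by simp) (by norm_num)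
    (by simp [hne])
  linarith

/-- A path of two edges whose first two vertices have a unique successor. -/
lemma KernelBoundBelow.of_unique_succ_chain (hR : ∀ a b, R a b → ¬ R b a)
    (hV : KernelBoundBelow R V) {p v w : α} (hp : p ∈ V) (hpv : outNbrs R V p = {v})
    (hvw : outNbrs R V v = {w}) (h4 : 4 ≤ (closedNbrs R V w).card) :
    ((kernels R V).card : ℝ) ≤ (123651 / 100000 : ℝ) ^ V.card := by
  have hmem : ∀ u, u ∈ V ∧ R p u ↔ u = v := fun u => by
    have := Finset.ext_iff.1 hpv u
    simpa [outNbrs] using this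
  have hmem' : ∀ u, u ∈ V ∧ R v u ↔ u = w := fun u => by
    have := Finset.ext_iff.1 hvw u
    simpa [outNbrs] using this
  obtain ⟨hv, rpv⟩ := (hmem v).2 rfl
  obtain ⟨hw, rvw⟩ := (hmem' w).2 rfl
  have hne : p ≠ v := by rintro rfl; exact hR _ _ rpv rpv
  have hne' : v ≠ w := by rintro rfl; exact hR _ _ rvw rvw
  have hne2 : p ≠ w := by rintro rfl; exact hR _ _ rpv rvw
  have hc := card_le_two_branches (kernels R V) (fun S => w ∈ S) (fun S => w ∉ S)
    fun S _ => em _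
  have hc' : ((kernels R V).card : ℝ) ≤ _ := Nat.cast_le.2 hc
  push_cast at hc'
  refine le_of_weight_le_one
    (w := (100000 / 123651 : ℝ) ^ 4 + (100000 / 123651 : ℝ) ^ 3) (by norm_num) ?_
  have h1 := hV.branch_mem w (by norm_num) h4
  have h2 := ((card_filter_notMem_le (R := R) (V := V) w).trans
    (card_kernels_le_erase_of_sink (v := v) (by simp [*]) fun u hu hvu =>
      (Finset.mem_erase.1 hu).1 ((hmem' u).1 ⟨(Finset.mem_erase.1 hu).2, hvu⟩))).trans
    (card_kernels_le_erase_of_sink (v := p) (by simp [*]) fun u hu hpu =>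
      (Finset.mem_erase.1 hu).1 ((hmem u).1
        ⟨Finset.mem_of_mem_erase (Finset.mem_of_mem_erase hu), hpu⟩))
  have h2' : (((kernels R V).filter fun S => w ∉ S).card : ℝ) ≤ _ := Nat.cast_le.2 h2
  have h3 := hV.card_le (W := ((V.erase w).erase v).erase p) (Z := {p, v, w}) (m := 3)
    (((Finset.erase_subset _ _).trans (Finset.erase_subset _ _)).trans (Finset.erase_subset _ _))
    (by simp [Finset.insert_subset_iff, *]) (by simp) (by norm_num)
    (by simp [*])
  linarith

/-- A vertex with two predecessors, all three of degree at least four and one of larger degree. -/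
lemma KernelBoundBelow.of_two_preds_of_degree (hV : KernelBoundBelow R V) {p q v : α}
    (hv : v ∈ V) (h : inNbrs R V v = {p, q}) (hv5 : 5 ≤ (closedNbrs R V v).card)
    (hp5 : 5 ≤ (closedNbrs R V p).card) (hq5 : 5 ≤ (closedNbrs R V q).card)
    (h6 : 6 ≤ (closedNbrs R V v).card ∨ 6 ≤ (closedNbrs R V p).card ∨
      6 ≤ (closedNbrs R V q).card) :
    ((kernels R V).card : ℝ) ≤ (123651 / 100000 : ℝ) ^ V.card := by
  have hc := card_le_three_branches (kernels R V) (fun S => v ∈ S) (fun S => p ∈ S)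
    (fun S => q ∈ S) fun S hS => by
      by_contra! hn
      obtain ⟨b, hb, hbv, hbS⟩ := kernels_exists_pred hS hv hn.1
      have : b ∈ inNbrs R V v := Finset.mem_filter.2 ⟨hb, hbv⟩
      rw [h] at this
      simp only [Finset.mem_insert, Finset.mem_singleton] at this
      rcases this with rfl | rfl <;> tauto
  have hc' : ((kernels R V).card : ℝ) ≤ _ := Nat.cast_le.2 hc
  push_cast at hc'
  refine le_of_weight_le_one (w := (100000 / 123651 : ℝ) ^ 5 + (100000 / 123651 : ℝ) ^ 5 +
    (100000 / 123651 : ℝ) ^ 6) (by norm_num) ?_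
  have hv' := hV.branch_mem v (by norm_num) hv5
  have hp' := hV.branch_mem p (by norm_num) hp5
  have hq' := hV.branch_mem q (by norm_num) hq5
  rcases h6 with h6 | h6 | h6
  · linarith [hV.branch_mem v (by norm_num) h6]
  · linarith [hV.branch_mem p (by norm_num) h6]
  · linarith [hV.branch_mem q (by norm_num) h6]

/-- A vertex with two nonadjacent predecessors, all three of degree at least four. -/
lemma KernelBoundBelow.of_two_preds_of_not_adj (hV : KernelBoundBelow R V) {p q v : α}
    (hv : v ∈ V) (h : inNbrs R V v = {p, q}) (hne : p ≠ q)
    (hv5 : 5 ≤ (closedNbrs R V v).card)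
    (hp5 : 5 ≤ (closedNbrs R V p).card) (hq5 : 5 ≤ (closedNbrs R V q).card)
    (hpq : ¬ R p q) (hqp : ¬ R q p) :
    ((kernels R V).card : ℝ) ≤ (123651 / 100000 : ℝ) ^ V.card := by
  have hp : p ∈ V := (Finset.mem_filter.1 (show p ∈ inNbrs R V v by simp [h])).1
  have hc := card_le_three_branches (kernels R V) (fun S => v ∈ S) (fun S => p ∈ S)
    (fun S => q ∈ S ∧ p ∉ S) fun S hS => by
      by_contra! hn
      obtain ⟨b, hb, hbv, hbS⟩ := kernels_exists_pred hS hv hn.1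
      have : b ∈ inNbrs R V v := Finset.mem_filter.2 ⟨hb, hbv⟩
      rw [h] at this
      simp only [Finset.mem_insert, Finset.mem_singleton] at this
      rcases this with rfl | rfl <;> tauto
  have hc' : ((kernels R V).card : ℝ) ≤ _ := Nat.cast_le.2 hc
  push_cast at hc'
  refine le_of_weight_le_one (w := (100000 / 123651 : ℝ) ^ 5 + (100000 / 123651 : ℝ) ^ 5 +
    (100000 / 123651 : ℝ) ^ 6) (by norm_num) ?_
  have hv' := hV.branch_mem v (by norm_num) hv5
  have hp' := hV.branch_mem p (by norm_num) hp5
  have hpn : p ∉ closedNbrs R V q := by simp [closedNbrs, *]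
  have hq' := hV.branch (F := fun S => q ∈ S ∧ p ∉ S) {q} {p} (insert p (closedNbrs R V q))
    (m := 6) (by norm_num) (by rw [Finset.card_insert_of_notMem hpn]; omega)
    (fun S _ hF => by simpa using hF.1) (fun S _ hF => by simpa using hF.2)
    (Finset.insert_subset hp (Finset.filter_subset _ _)) (by
      intro z hz
      rcases Finset.mem_insert.1 hz with rfl | hz
      · simp
      · exact Or.inr ⟨q, by simp, (Finset.mem_filter.1 hz).2⟩)
  linarith

/-- A vertex with two predecessors `p` and `q`, where `q` has exactly the predecessors `p`
and `r`. -/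
lemma KernelBoundBelow.of_two_preds_of_adj (hR : ∀ a b, R a b → ¬ R b a)
    (hV : KernelBoundBelow R V) {p q r v : α}
    (hv : v ∈ V) (h : inNbrs R V v = {p, q}) (hv5 : 5 ≤ (closedNbrs R V v).card)
    (hp5 : 5 ≤ (closedNbrs R V p).card) (hq5 : 5 ≤ (closedNbrs R V q).card)
    (hq : inNbrs R V q = {p, r}) :
    ((kernels R V).card : ℝ) ≤ (123651 / 100000 : ℝ) ^ V.card := by
  have hp' : p ∈ V ∧ R p v := Finset.mem_filter.1 (show p ∈ inNbrs R V v by simp [h])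
  have hq' : q ∈ V ∧ R q v := Finset.mem_filter.1 (show q ∈ inNbrs R V v by simp [h])
  have hr' : r ∈ V ∧ R r q := Finset.mem_filter.1 (show r ∈ inNbrs R V q by simp [hq])
  have hc := card_le_three_branches (kernels R V) (fun S => v ∈ S) (fun S => p ∈ S)
    (fun S => q ∈ S) fun S hS => by
      by_contra! hn
      obtain ⟨b, hb, hbv, hbS⟩ := kernels_exists_pred hS hv hn.1
      have : b ∈ inNbrs R V v := Finset.mem_filter.2 ⟨hb, hbv⟩
      rw [h] at this
      simp only [Finset.mem_insert, Finset.mem_singleton] at this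
      rcases this with rfl | rfl <;> tauto
  have hc' : ((kernels R V).card : ℝ) ≤ _ := Nat.cast_le.2 hc
  push_cast at hc'
  refine le_of_weight_le_one (w := (100000 / 123651 : ℝ) ^ 6 + (100000 / 123651 : ℝ) ^ 5 +
    (100000 / 123651 : ℝ) ^ 5) (by norm_num) ?_
  have hforce : ∀ S ∈ kernels R V, v ∈ S → r ∈ S := by
    intro S hS hvS
    have hqS : q ∉ S := fun hqS => kernels_indep hS hqS hvS hq'.2
    obtain ⟨b, hb, hbq, hbS⟩ := kernels_exists_pred hS hq'.1 hqS
    have : b ∈ inNbrs R V q := Finset.mem_filter.2 ⟨hb, hbq⟩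
    rw [hq] at this
    simp only [Finset.mem_insert, Finset.mem_singleton] at this
    rcases this with rfl | rfl
    · exact absurd hp'.2 (kernels_indep hS hbS hvS)
    · exact hbS
  have bv : (((kernels R V).filter fun S => v ∈ S).card : ℝ) ≤
      (123651 / 100000 : ℝ) ^ V.card * (100000 / 123651 : ℝ) ^ 6 := by
    by_cases hrv : r ∈ closedNbrs R V v
    · have : (kernels R V).filter (fun S => v ∈ S) = ∅ := by
        rw [Finset.filter_eq_empty_iff]
        intro S hS hvS
        have hrS := hforce S hS hvS
        rcases (Finset.mem_filter.1 hrv).2 with rfl | hadj | hadj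
        · exact hR _ _ hr'.2 hq'.2
        · exact kernels_indep hS hrS hvS hadj
        · exact kernels_indep hS hvS hrS hadj
      rw [this]
      simp only [Finset.card_empty, Nat.cast_zero]
      positivity
    · refine hV.branch {v, r} ∅ (insert r (closedNbrs R V v)) (by norm_num)
        (by rw [Finset.card_insert_of_notMem hrv]; omega) ?_ (by simp)
        (Finset.insert_subset hr'.1 (Finset.filter_subset _ _)) ?_
      · intro S hS hvS
        simp [Finset.insert_subset_iff, hforce S hS hvS, hvS]
      · intro z hz
        rcases Finset.mem_insert.1 hz with rfl | hz
        · exact Or.inr ⟨z, by simp⟩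
        · exact Or.inr ⟨v, by simp, (Finset.mem_filter.1 hz).2⟩
  have bp := hV.branch_mem p (by norm_num) hp5
  have bq := hV.branch_mem q (by norm_num) hq5
  linarith

/-- Branching on a vertex of degree at least seven. -/
lemma KernelBoundBelow.of_large_degree (hV : KernelBoundBelow R V) {v : α} (hv : v ∈ V)
    (h8 : 8 ≤ (closedNbrs R V v).card) :
    ((kernels R V).card : ℝ) ≤ (123651 / 100000 : ℝ) ^ V.card := by
  have hc := card_le_two_branches (kernels R V) (fun S => v ∈ S) (fun S => v ∉ S)
    fun S _ => em _
  have hc' : ((kernels R V).card : ℝ) ≤ _ := Nat.cast_le.2 hc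
  push_cast at hc'
  refine le_of_weight_le_one
    (w := (100000 / 123651 : ℝ) ^ 8 + (100000 / 123651 : ℝ) ^ 1) (by norm_num) ?_
  have h1 := hV.branch_mem v (by norm_num) h8
  have h2 := hV.branch (F := fun S => v ∉ S) ∅ {v} {v} (m := 1) (by norm_num) (by simp)
    (by simp) (by simp) (by simpa using hv) (by simp)
  linarith

/-- A vertex with three predecessors, where all degrees are at least six. -/
lemma KernelBoundBelow.of_three_preds (hV : KernelBoundBelow R V) {v : α} (hv : v ∈ V)
    (h3 : (inNbrs R V v).card = 3) (h7 : ∀ u ∈ V, 7 ≤ (closedNbrs R V u).card) :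
    ((kernels R V).card : ℝ) ≤ (123651 / 100000 : ℝ) ^ V.card := by
  have hcover : kernels R V ⊆
      (insert v (inNbrs R V v)).biUnion fun u => (kernels R V).filter fun S => u ∈ S := by
    intro S hS
    simp only [Finset.mem_biUnion, Finset.mem_filter]
    by_cases hvS : v ∈ S
    · exact ⟨v, by simp, hS, hvS⟩
    · obtain ⟨b, hb, hbv, hbS⟩ := kernels_exists_pred hS hv hvS
      exact ⟨b, by simp [inNbrs, hb, hbv], hS, hbS⟩
  have hc := (Finset.card_le_card hcover).trans Finset.card_biUnion_le
  have hc' : ((kernels R V).card : ℝ) ≤ _ := Nat.cast_le.2 hc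
  push_cast at hc'
  have hsum := Finset.sum_le_card_nsmul (insert v (inNbrs R V v))
    (fun u => (((kernels R V).filter fun S => u ∈ S).card : ℝ)) _ fun u hu =>
      hV.branch_mem u (by norm_num) (h7 u (by
        rcases Finset.mem_insert.1 hu with rfl | hu
        · exact hv
        · exact (Finset.mem_filter.1 hu).1))
  have hcard : (((insert v (inNbrs R V v)).card : ℕ) : ℝ) ≤ 4 := by
    have := Finset.card_insert_le v (inNbrs R V v)
    exact_mod_cast this.trans (by omega)
  refine le_of_weight_le_one (w := 4 * (100000 / 123651 : ℝ) ^ 7) (by norm_num) ?_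
  rw [nsmul_eq_mul] at hsum
  have hpos : (0 : ℝ) ≤ (123651 / 100000 : ℝ) ^ V.card * (100000 / 123651 : ℝ) ^ 7 := by
    positivity
  nlinarith [mul_le_mul_of_nonneg_right hcard hpos]

/-- An oriented graph in which all in-degrees are at least three and all out-degrees at most
three is regular. -/
lemma degrees_eq_three (hin : ∀ v ∈ V, 3 ≤ (inNbrs R V v).card)
    (hout : ∀ v ∈ V, (outNbrs R V v).card ≤ 3) :
    ∀ v ∈ V, (inNbrs R V v).card = 3 ∧ (outNbrs R V v).card = 3 := by
  have hsum : ∑ v ∈ V, (outNbrs R V v).card = ∑ v ∈ V, (inNbrs R V v).card :=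
    Finset.sum_card_bipartiteAbove_eq_sum_card_bipartiteBelow R
  have heq := (Finset.sum_eq_sum_iff_of_le fun v hv => (hout v hv).trans (hin v hv)).1 hsum
  intro v hv
  have := heq v hv
  have := hin v hv
  have := hout v hv
  omega

lemma KernelBoundBelow.step (hR : ∀ a b, R a b → ¬ R b a) (hV : KernelBoundBelow R V) :
    ((kernels R V).card : ℝ) ≤ (123651 / 100000 : ℝ) ^ V.card := by
  rcases V.eq_empty_or_nonempty with rfl | hne
  · have : (kernels R (∅ : Finset α)).card ≤ 1 := Finset.card_filter_le _ _
    simpa using this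
  by_cases hsink : ∃ v ∈ V, (outNbrs R V v).card = 0
  · obtain ⟨v, hv, h0⟩ := hsink
    rw [Finset.card_eq_zero, outNbrs, Finset.filter_eq_empty_iff] at h0
    have h1 : ((kernels R V).card : ℝ) ≤ _ :=
      Nat.cast_le.2 (card_kernels_le_erase_of_sink hv fun u hu => h0 hu)
    refine le_of_weight_le_one (by norm_num) (h1.trans (hV.card_le (Z := {v}) (m := 1)
      (Finset.erase_subset _ _) (by simpa using hv) (by simp) (by norm_num) (by simp)))
  by_cases hsource : ∃ v ∈ V, (inNbrs R V v).card = 0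
  · obtain ⟨v, hv, h0⟩ := hsource
    rw [Finset.card_eq_zero, inNbrs, Finset.filter_eq_empty_iff] at h0
    have h1 := hV.branch (F := fun _ => True) {v} ∅ {v} (m := 1) (by norm_num) (by simp)
      (fun S hS _ => by
        simpa using ((mem_kernels.1 hS).2 v hv).2 fun b hb hbv => absurd hbv (h0 hb))
      (by simp) (by simpa using hv) (by simp)
    rw [Finset.filter_true] at h1
    exact le_of_weight_le_one (by norm_num) h1
  have hout1 : ∀ v ∈ V, 1 ≤ (outNbrs R V v).card := fun v hv =>
    Nat.one_le_iff_ne_zero.2 fun h => hsink ⟨v, hv, h⟩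
  have hin1 : ∀ v ∈ V, 1 ≤ (inNbrs R V v).card := fun v hv =>
    Nat.one_le_iff_ne_zero.2 fun h => hsource ⟨v, hv, h⟩
  have hcl := fun v (hv : v ∈ V) => card_closedNbrs hR hv
  by_cases hone : ∃ v ∈ V, (inNbrs R V v).card = 1
  · obtain ⟨v, hv, h1⟩ := hone
    obtain ⟨u, hu⟩ := Finset.card_eq_one.1 h1
    have huV := (pred_of_inNbrs hu).1
    have := hcl v hv
    have := hcl u huV
    have := hout1 v hv
    have := hout1 u huV
    have := hin1 u huV
    by_cases h4 : 4 ≤ (closedNbrs R V u).card ∨ 4 ≤ (closedNbrs R V v).card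
    · exact hV.of_unique_pred_of_degree hv hu (by omega) (by omega) h4
    obtain ⟨w, hw⟩ := Finset.card_eq_one.1 (show (inNbrs R V u).card = 1 by omega)
    have hwV := (pred_of_inNbrs hw).1
    have := hcl w hwV
    have := hout1 w hwV
    have := hin1 w hwV
    by_cases h4' : 4 ≤ (closedNbrs R V w).card
    · exact hV.of_unique_pred_of_degree huV hw (by omega) (by omega) (Or.inl h4')
    obtain ⟨t, ht⟩ := Finset.card_eq_one.1 (show (inNbrs R V w).card = 1 by omega)
    exact hV.of_unique_pred_chain hR hv hu hw ht
  have hin2 : ∀ v ∈ V, 2 ≤ (inNbrs R V v).card := fun v hv => by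
    have := hin1 v hv
    have : (inNbrs R V v).card ≠ 1 := fun h => hone ⟨v, hv, h⟩
    omega
  by_cases hone' : ∃ v ∈ V, (outNbrs R V v).card = 1
  · obtain ⟨p, hp, h1⟩ := hone'
    obtain ⟨v, hpv⟩ := Finset.card_eq_one.1 h1
    have hvV : v ∈ V := (Finset.mem_filter.1 (show v ∈ outNbrs R V p by simp [hpv])).1
    have := hcl v hvV
    have := hout1 v hvV
    have := hin2 v hvV
    by_cases h5 : 5 ≤ (closedNbrs R V v).card
    · exact hV.of_unique_succ_of_degree hR hp hpv h5
    obtain ⟨w, hvw⟩ := Finset.card_eq_one.1 (show (outNbrs R V v).card = 1 by omega)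
    have hwV : w ∈ V := (Finset.mem_filter.1 (show w ∈ outNbrs R V v by simp [hvw])).1
    have := hcl w hwV
    have := hout1 w hwV
    have := hin2 w hwV
    exact hV.of_unique_succ_chain hR hp hpv hvw (by omega)
  have hout2 : ∀ v ∈ V, 2 ≤ (outNbrs R V v).card := fun v hv => by
    have := hout1 v hv
    have : (outNbrs R V v).card ≠ 1 := fun h => hone' ⟨v, hv, h⟩
    omega
  have hcl5 : ∀ v ∈ V, 5 ≤ (closedNbrs R V v).card := fun v hv => by
    have := hcl v hv
    have := hin2 v hv
    have := hout2 v hv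
    omega
  by_cases htwo : ∃ v ∈ V, (inNbrs R V v).card = 2
  · obtain ⟨v, hv, h2⟩ := htwo
    obtain ⟨p, q, hpq, h⟩ := Finset.card_eq_two.1 h2
    have hp : p ∈ V := (Finset.mem_filter.1 (show p ∈ inNbrs R V v by simp [h])).1
    have hq : q ∈ V := (Finset.mem_filter.1 (show q ∈ inNbrs R V v by simp [h])).1
    by_cases h6 : 6 ≤ (closedNbrs R V v).card ∨ 6 ≤ (closedNbrs R V p).card ∨
      6 ≤ (closedNbrs R V q).card
    · exact hV.of_two_preds_of_degree hv h (hcl5 v hv) (hcl5 p hp) (hcl5 q hq) h6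
    have adj : ∀ p q, p ∈ V → q ∈ V → R p q → inNbrs R V v = {p, q} →
        ¬ 6 ≤ (closedNbrs R V q).card →
        ((kernels R V).card : ℝ) ≤ (123651 / 100000 : ℝ) ^ V.card := by
      intro p q hp hq rpq h h6
      have := hcl q hq
      have := hin2 q hq
      have := hout2 q hq
      have hpin : p ∈ inNbrs R V q := Finset.mem_filter.2 ⟨hp, rpq⟩
      obtain ⟨r, hr⟩ := Finset.card_eq_one.1
        (show ((inNbrs R V q).erase p).card = 1 by
          rw [Finset.card_erase_of_mem hpin]; omega)
      exact hV.of_two_preds_of_adj hR hv h (hcl5 v hv) (hcl5 p hp) (hcl5 q hq)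
        (r := r) (by rw [← hr, Finset.insert_erase hpin])
    by_cases rpq : R p q
    · exact adj p q hp hq rpq h (by tauto)
    by_cases rqp : R q p
    · exact adj q p hq hp rqp (by rw [h, Finset.pair_comm]) (by tauto)
    exact hV.of_two_preds_of_not_adj hv h hpq (hcl5 v hv) (hcl5 p hp) (hcl5 q hq) rpq rqp
  have hin3 : ∀ v ∈ V, 3 ≤ (inNbrs R V v).card := fun v hv => by
    have := hin2 v hv
    have : (inNbrs R V v).card ≠ 2 := fun h => htwo ⟨v, hv, h⟩
    omega
  by_cases h8 : ∃ v ∈ V, 8 ≤ (closedNbrs R V v).card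
  · obtain ⟨v, hv, h8⟩ := h8
    exact hV.of_large_degree hv h8
  have hreg := degrees_eq_three hin3 fun v hv => by
    have : ¬ 8 ≤ (closedNbrs R V v).card := fun h => h8 ⟨v, hv, h⟩
    have := hcl v hv
    have := hin3 v hv
    omega
  obtain ⟨v, hv⟩ := hne
  exact hV.of_three_preds hv (hreg v hv).1 fun u hu => by
    have := hcl u hu
    have := hreg u hu
    omega

/-- The number of kernels of an oriented graph. -/
theorem card_kernels_le (hR : ∀ a b, R a b → ¬ R b a) (V : Finset α) :
    ((kernels R V).card : ℝ) ≤ (123651 / 100000 : ℝ) ^ V.card := by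
  induction V using Finset.strongInduction with
  | H V ih => exact KernelBoundBelow.step hR ih

end Kernels

/-- In a definite purely negative program a stable model consists of the heads of the clauses
whose negative body it avoids. -/
lemma IsStable.mem_iff {α : Type} {P : LPProgram α} (hpos : ∀ c ∈ P, c.pos = ∅) {M : Finset α}
    (hM : IsStable P M) (a : α) :
    a ∈ M ↔ ∃ c ∈ P, c.head = some a ∧ ∀ b ∈ c.neg, b ∉ M := by
  constructor
  · intro ha
    exact hM.2.1 {a | ∃ c ∈ P, c.head = some a ∧ ∀ b ∈ c.neg, b ∉ M}
      (fun c hc h hh hn _ => ⟨c, hc, hh, hn⟩) ha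
  · rintro ⟨c, hc, hh, hn⟩
    exact hM.1 c hc a hh hn (by simp [hpos c hc])

lemma LPProgram.mem_atoms {α : Type} [DecidableEq α] {P : LPProgram α} {c : LPClause α}
    (hc : c ∈ P) {a : α} (ha : a ∈ c.atoms) : a ∈ P.atoms :=
  Finset.mem_sup.2 ⟨c, hc, ha⟩

/-- A clause of a definite purely negative 2-program is a fact or has the form `a ← not b`. -/
lemma IsTProgram.eq_fact_or_eq_not {α : Type} {P : LPProgram α} (ht : IsTProgram P 2)
    (hpos : ∀ c ∈ P, c.pos = ∅) {c : LPClause α} (hc : c ∈ P) {a : α} (ha : c.head = some a) :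
    c = ⟨some a, ∅, ∅⟩ ∨ ∃ b, c = ⟨some a, ∅, {b}⟩ := by
  have h := ht c hc
  have hp := hpos c hc
  obtain ⟨hd, pos, neg⟩ := c
  subst hp ha
  simp only [Finset.card_empty, Option.elim_some] at h
  rcases Nat.le_one_iff_eq_zero_or_eq_one.1 (show neg.card ≤ 1 by omega) with h0 | h1
  · left
    rw [Finset.card_eq_zero.1 h0]
  · obtain ⟨b, rfl⟩ := Finset.card_eq_one.1 h1
    exact Or.inr ⟨b, rfl⟩

/-- Complements of stable models are kernels of the digraph with an edge from `b` to `a` for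
every clause `a ← not b`, on the atoms that are not facts and have no loop. -/
lemma ncard_stable_le_card_kernels {α : Type} [DecidableEq α] {P : LPProgram α}
    (hpos : ∀ c ∈ P, c.pos = ∅) (ht : IsTProgram P 2) :
    {M : Finset α | IsStable P M}.ncard ≤
      (kernels (fun b a => a ≠ b ∧ (⟨some a, ∅, {b}⟩ : LPClause α) ∈ P)
        (P.atoms.filter fun a => (⟨some a, ∅, ∅⟩ : LPClause α) ∉ P ∧
          (⟨some a, ∅, {a}⟩ : LPClause α) ∉ P)).card := by
  rw [← Set.ncard_coe_finset]
  have hiff : ∀ M, IsStable P M → ∀ a, a ∈ M ↔ (⟨some a, ∅, ∅⟩ : LPClause α) ∈ P ∨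
      ∃ b, (⟨some a, ∅, {b}⟩ : LPClause α) ∈ P ∧ b ∉ M := by
    intro M hM a
    rw [hM.mem_iff hpos]
    constructor
    · rintro ⟨c, hc, hh, hn⟩
      rcases ht.eq_fact_or_eq_not hpos hc hh with rfl | ⟨b, rfl⟩
      · exact Or.inl hc
      · exact Or.inr ⟨b, hc, hn b (by simp)⟩
    · rintro (hc | ⟨b, hc, hb⟩)
      · exact ⟨_, hc, rfl, by simp⟩
      · exact ⟨_, hc, rfl, by simpa using hb⟩
  have hsub : ∀ M, IsStable P M → M ⊆ P.atoms := by
    intro M hM a ha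
    obtain ⟨c, hc, hh, -⟩ := (hM.mem_iff hpos a).1 ha
    exact LPProgram.mem_atoms hc (by simp [LPClause.atoms, hh])
  refine Set.ncard_le_ncard_of_injOn (fun M => P.atoms \ M) ?_ ?_ (Finset.finite_toSet _)
  · intro M hM
    have hM' := hiff M hM
    have hmem : ∀ a ∈ P.atoms, a ∉ M → (⟨some a, ∅, ∅⟩ : LPClause α) ∉ P ∧
        (⟨some a, ∅, {a}⟩ : LPClause α) ∉ P := by
      intro a _ haM
      exact ⟨fun h => haM ((hM' a).2 (Or.inl h)), fun h => haM ((hM' a).2 (Or.inr ⟨a, h, haM⟩))⟩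
    refine Finset.mem_coe.2 (mem_kernels.2 ⟨?_, ?_⟩)
    · intro a ha
      obtain ⟨haP, haM⟩ := Finset.mem_sdiff.1 ha
      exact Finset.mem_filter.2 ⟨haP, hmem a haP haM⟩
    · intro a ha
      obtain ⟨haP, hfact, hloop⟩ := Finset.mem_filter.1 ha
      rw [Finset.mem_sdiff, hM' a]
      constructor
      · rintro ⟨-, h⟩ b - ⟨-, hb⟩ hbM
        exact h (Or.inr ⟨b, hb, (Finset.mem_sdiff.1 hbM).2⟩)
      · refine fun h => ⟨haP, ?_⟩
        rintro (h' | ⟨b, hb, hbM⟩)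
        · exact hfact h'
        · have hbP : b ∈ P.atoms := LPProgram.mem_atoms hb (by simp [LPClause.atoms])
          refine h b (Finset.mem_filter.2 ⟨hbP, hmem b hbP hbM⟩) ⟨?_, hb⟩
            (Finset.mem_sdiff.2 ⟨hbP, hbM⟩)
          rintro rfl
          exact hloop hb
  · intro M hM M' hM' h
    rw [← Finset.sdiff_sdiff_eq_self (hsub M hM), ← Finset.sdiff_sdiff_eq_self (hsub M' hM')]
    exact congrArg (P.atoms \ ·) h

/-- There is a constant `C > 0` such that every definite, purely negative
2-program without dual clauses and with `n` atoms has at most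
`C * 1.23651 ^ n` stable models. -/
theorem stmt_16 :
    ∃ C : ℝ, 0 < C ∧ ∀ (α : Type) [DecidableEq α] (P : LPProgram α),
      (∀ c ∈ P, c.head ≠ none) →
      (∀ c ∈ P, c.pos = ∅) →
      IsTProgram P 2 →
      (∀ a b : α, a ≠ b →
        ¬((⟨some a, ∅, {b}⟩ : LPClause α) ∈ P ∧ (⟨some b, ∅, {a}⟩ : LPClause α) ∈ P)) →
      ({M : Finset α | IsStable P M}.ncard : ℝ) ≤
        C * (123651 / 100000 : ℝ) ^ P.atoms.card := by
  refine ⟨1, one_pos, fun α _ P _ hpos ht hdual => ?_⟩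
  rw [one_mul]
  refine (Nat.cast_le.2 (ncard_stable_le_card_kernels hpos ht)).trans
    ((card_kernels_le ?_ _).trans ?_)
  · rintro a b ⟨hne, hab⟩ ⟨-, hba⟩
    exact hdual b a hne ⟨hab, hba⟩
  · exact pow_le_pow_right₀ (by norm_num) (Finset.card_filter_le _ _)
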